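/- (Sufficient condition for generalized Gabor frames.) Fix s ≥ 0 and let v(z) = (1+|z|)^s on ℝ^{2d}. Let g ∈ L¹(ℝ^d), g ≠ 0, with ĝ ∈ L¹(ℝ^d), and let L be an invertible real 2d×2d matrix such that Σ_{κ∈ℤ^{2d}, κ≠0} v(𝒥L^{−T}κ) |V_g g(𝒥L^{−T}κ)| < ‖g‖²_{L²}. Then the Gabor system {π_{Lκ} g}_{κ∈ℤ^{2d}} is a frame for L²(ℝ^d): with A := (2‖g‖²_{L²} − σ_{L,g})/|det L| and B := σ_{L,g}/|det L|, where σ_{L,g} := Σ_{κ∈ℤ^{2d}} v(𝒥L^{−T}κ) |V_g g(𝒥L^{−T}κ)|, one has A > 0, B < 2‖g‖²_{L²}/|det L|, and A ‖f‖²_{L²} ≤ Σ_{κ∈ℤ^{2d}} |(f, π_{Lκ} g)_{L²}|² ≤ B ‖f‖²_{L²} for all f ∈ L²(ℝ^d). -/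

import Mathlib

open MeasureTheory Matrix Filter
open scoped ENNReal NNReal

noncomputable section

/-- `ℝ^d` with the Euclidean norm. -/
abbrev Euc (d : ℕ) := EuclideanSpace ℝ (Fin d)

/-- Index set for `ℝ^{2d} = ℝ^d × ℝ^d`. -/
abbrev ι2 (d : ℕ) := Sum (Fin d) (Fin d)

/-- Turn a plain vector into a point of Euclidean space. -/
def toE {d : ℕ} (x : Fin d → ℝ) : Euc d := (EuclideanSpace.equiv (Fin d) ℝ).symm x

/-- The Euclidean norm of a vector of `ℝ^{2d}`. -/
def norm2 {d : ℕ} (z : ι2 d → ℝ) : ℝ := ‖(EuclideanSpace.equiv (ι2 d) ℝ).symm z‖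

/-- `e^{2πit}`. -/
def e2 (t : ℝ) : ℂ := Complex.exp (2 * Real.pi * Complex.I * t)

/-- The dot product `x·ω = ∑ⱼ xⱼωⱼ`. -/
def dotE {d : ℕ} (x y : Euc d) : ℝ := ∑ j, x j * y j

/-- First (time) component of `z = (x,ω) ∈ ℝ^{2d}`. -/
def xpart {d : ℕ} (z : ι2 d → ℝ) : Euc d := toE fun i => z (Sum.inl i)

/-- Second (frequency) component of `z = (x,ω) ∈ ℝ^{2d}`. -/
def wpart {d : ℕ} (z : ι2 d → ℝ) : Euc d := toE fun i => z (Sum.inr i)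

/-- The symplectic matrix `𝒥` as a map: `𝒥(x,ω) = (-ω,x)`. -/
def Jmap {d : ℕ} (z : ι2 d → ℝ) : ι2 d → ℝ :=
  Sum.elim (fun i => -(z (Sum.inr i))) (fun i => z (Sum.inl i))

/-- Time-frequency shift `π_z f(t) = e^{2πi ω·t} f(t-x)` for `z = (x,ω)`. -/
def tfs {d : ℕ} (z : ι2 d → ℝ) (f : Euc d → ℂ) (t : Euc d) : ℂ :=
  e2 (dotE (wpart z) t) * f (t - xpart z)

/-- The short-time Fourier transform
`V_gγ(x,ω) = ∫ γ(t) e^{-2πi ω·t} conj(g(t-x)) dt`. -/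
def STFT {d : ℕ} (g γ : Euc d → ℂ) (x ω : Euc d) : ℂ :=
  ∫ t : Euc d, γ t * e2 (-(dotE ω t)) * (starRingEnd ℂ) (g (t - x))

/-- The vector `Lκ ∈ ℝ^{2d}` for `κ ∈ ℤ^{2d}`. -/
def latV {d : ℕ} (L : Matrix (ι2 d) (ι2 d) ℝ) (κ : ι2 d → ℤ) : ι2 d → ℝ :=
  L.mulVec fun i => (κ i : ℝ)

/-- The dual lattice vector `𝒥 L^{-T} κ ∈ ℝ^{2d}`. -/
def dualV {d : ℕ} (L : Matrix (ι2 d) (ι2 d) ℝ) (κ : ι2 d → ℤ) : ι2 d → ℝ :=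
  Jmap ((L⁻¹)ᵀ.mulVec fun i => (κ i : ℝ))

/-- The order `|κ| = ∑ᵢ |κᵢ|` of `κ ∈ ℤ^{2d}`. -/
def ordκ {d : ℕ} (κ : ι2 d → ℤ) : ℕ := ∑ i, (κ i).natAbs


lemma conj_e2 (t : ℝ) : (starRingEnd ℂ) (e2 t) = e2 (-t) := by
  rw [e2, e2, ← Complex.exp_conj]
  congr 1
  simp only [map_mul, Complex.conj_ofReal, Complex.conj_I, Complex.ofReal_neg, map_ofNat]
  ring

lemma e2_add (s t : ℝ) : e2 (s + t) = e2 s * e2 t := by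
  rw [e2, e2, e2, ← Complex.exp_add]
  congr 1
  push_cast; ring

lemma e2_zero : e2 0 = 1 := by simp [e2]

lemma norm_e2 (t : ℝ) : ‖e2 t‖ = 1 := by
  rw [e2, show (2 * Real.pi * Complex.I * t : ℂ) = ((2 * Real.pi * t : ℝ) : ℂ) * Complex.I by
    push_cast; ring, Complex.norm_exp_ofReal_mul_I]

lemma continuous_e2 : Continuous e2 := by unfold e2; fun_prop

lemma e2_mul_conj (t : ℝ) : e2 t * (starRingEnd ℂ) (e2 t) = 1 := by
  rw [conj_e2, ← e2_add, add_neg_cancel, e2_zero]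


open scoped FourierTransform SchwartzMap

lemma fourier_toLp_ae {d : ℕ} {h : Euc d → ℂ} (h1 : Integrable h) (h2 : MemLp h 2) :
    (𝓕 (h2.toLp h) : Lp ℂ 2 (volume : Measure (Euc d))) =ᵐ[volume] 𝓕 h := by
  have hcont : Continuous (𝓕 h) := by
    apply VectorFourier.fourierIntegral_continuous Real.continuous_fourierChar
      (by exact continuous_inner) h1
  apply ae_eq_of_integral_contDiff_smul_eq
  · exact (Lp.memLp _).locallyIntegrable (by norm_num)
  · exact hcont.locallyIntegrable
  intro φ hφ hc
  let ψ : Euc d → ℂ := fun x => (φ x : ℂ)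
  have hψ : ContDiff ℝ ((⊤ : ℕ∞) : WithTop ℕ∞) ψ := Complex.ofRealCLM.contDiff.comp hφ
  have hψc : HasCompactSupport ψ := hc.comp_left (g := fun x : ℝ => (x:ℂ)) (by simp)
  let Φ : 𝓢(Euc d, ℂ) := hψc.toSchwartzMap hψ
  have hΦ : ∀ x, Φ x = (φ x : ℂ) := fun x => by simp [Φ, ψ]
  have e1 := congrArg (fun T : 𝓢'(Euc d, ℂ) => T Φ) (Lp.fourier_toTemperedDistribution_eq (h2.toLp h))
  simp only [TemperedDistribution.fourier_apply, Lp.toTemperedDistribution_apply] at e1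
  have e2' : ∫ x, φ x • (𝓕 (h2.toLp h) : Lp ℂ 2 (volume : Measure (Euc d))) x
      = ∫ x, (𝓕 Φ) x • (h2.toLp h) x := by
    rw [e1]; rfl
  rw [e2']
  have e3 : ∫ x, (𝓕 Φ) x • (h2.toLp h) x = ∫ x, (𝓕 Φ) x • h x := by
    apply integral_congr_ae
    filter_upwards [h2.coeFn_toLp] with x hx
    rw [hx]
  rw [e3, SchwartzMap.fourier_coe]
  have := VectorFourier.integral_fourierIntegral_smul_eq_flip (L := innerₗ (Euc d)) (μ := volume) (ν := volume)
    (f := Φ) (g := h) Real.continuous_fourierChar (by exact continuous_inner) Φ.integrable h1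
  rw [flip_innerₗ] at this
  refine Eq.trans this ?_
  rfl

lemma parseval {d : ℕ} {h k : Euc d → ℂ} (h1 : Integrable h) (h2 : MemLp h 2)
    (k1 : Integrable k) (k2 : MemLp k 2) :
    ∫ ω, (𝓕 h) ω * (starRingEnd ℂ) ((𝓕 k) ω) = ∫ t, h t * (starRingEnd ℂ) (k t) := by
  have := Lp.inner_fourier_eq (k2.toLp k) (h2.toLp h)
  rw [L2.inner_def, L2.inner_def] at this
  refine Eq.trans (integral_congr_ae ?_) (this.trans (integral_congr_ae ?_))
  · filter_upwards [fourier_toLp_ae h1 h2, fourier_toLp_ae k1 k2] with x hx hy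
    rw [hx, hy]; simp
  · filter_upwards [h2.coeFn_toLp, k2.coeFn_toLp] with x hx hy
    rw [hx, hy]; simp

lemma memLp_fourier {d : ℕ} {h : Euc d → ℂ} (h1 : Integrable h) (h2 : MemLp h 2) :
    MemLp (𝓕 h) 2 := (Lp.memLp (𝓕 (h2.toLp h))).ae_eq (fourier_toLp_ae h1 h2)


section TF
variable {d : ℕ}

lemma dotE_eq_inner (x y : Euc d) : dotE x y = inner ℝ x y := by
  simp [dotE, PiLp.inner_apply, mul_comm]

lemma continuous_dotE : Continuous fun p : Euc d × Euc d => dotE p.1 p.2 := by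
  simp only [dotE_eq_inner]; exact continuous_inner

lemma dotE_add_left (x y z : Euc d) : dotE (x + y) z = dotE x z + dotE y z := by
  simp [dotE_eq_inner, inner_add_left]
lemma dotE_sub_right (x y z : Euc d) : dotE x (y - z) = dotE x y - dotE x z := by
  simp [dotE_eq_inner, inner_sub_right]
lemma dotE_add_right (x y z : Euc d) : dotE x (y + z) = dotE x y + dotE x z := by
  simp [dotE_eq_inner, inner_add_right]
lemma dotE_comm (x y : Euc d) : dotE x y = dotE y x := by
  simp [dotE, mul_comm]
lemma dotE_neg_left (x y : Euc d) : dotE (-x) y = - dotE x y := by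
  simp [dotE_eq_inner]

lemma continuous_xpart : Continuous (xpart (d := d)) := by
  unfold xpart toE; fun_prop
lemma continuous_wpart : Continuous (wpart (d := d)) := by
  unfold wpart toE; fun_prop
lemma xpart_add (z w : ι2 d → ℝ) : xpart (z + w) = xpart z + xpart w := by
  ext i; simp [xpart, toE]
lemma wpart_add (z w : ι2 d → ℝ) : wpart (z + w) = wpart z + wpart w := by
  ext i; simp [wpart, toE]
lemma xpart_zero : xpart (0 : ι2 d → ℝ) = 0 := by
  ext i; simp [xpart, toE]
lemma wpart_zero : wpart (0 : ι2 d → ℝ) = 0 := by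
  ext i; simp [wpart, toE]

lemma continuous_e2_dot (ω : Euc d) : Continuous fun t => e2 (dotE ω t) :=
  continuous_e2.comp (continuous_dotE.comp (by fun_prop : Continuous fun t : Euc d => (ω, t)))

abbrev L2E (d : ℕ) := Lp ℂ 2 (volume : Measure (Euc d))

lemma memLp_mod (ω : Euc d) {u : Euc d → ℂ} (hu : MemLp u 2) :
    MemLp (fun t => e2 (dotE ω t) * u t) 2 := by
  refine hu.of_le ((continuous_e2_dot ω).aestronglyMeasurable.mul hu.1) ?_
  filter_upwards with t
  rw [norm_mul, norm_e2, one_mul]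

lemma memLp_tr (x : Euc d) {u : Euc d → ℂ} (hu : MemLp u 2) :
    MemLp (fun t => u (t - x)) 2 :=
  hu.comp_measurePreserving (measurePreserving_sub_right volume x)

lemma memLp_tfs (z : ι2 d → ℝ) {u : Euc d → ℂ} (hu : MemLp u 2) : MemLp (tfs z u) 2 :=
  memLp_mod (wpart z) (memLp_tr (xpart z) hu)

lemma norm_sq_L2 (u : L2E d) : ‖u‖ ^ 2 = ∫ t, ‖u t‖ ^ 2 := by
  have h := inner_self_eq_norm_sq_to_K (𝕜 := ℂ) u
  rw [L2.inner_def] at h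
  have : ∀ t, inner ℂ (u t) (u t) = ((‖u t‖ ^ 2 : ℝ) : ℂ) := fun t => by
    rw [inner_self_eq_norm_sq_to_K]; simp
  simp only [this] at h
  rw [integral_complex_ofReal] at h
  have h' : ((∫ t, ‖u t‖ ^ 2 : ℝ) : ℂ) = ((‖u‖ ^ 2 : ℝ) : ℂ) := by rw [h]; simp
  exact (Complex.ofReal_injective h').symm

/-- Modulation on `L²`. -/
def ModE (ω : Euc d) (u : L2E d) : L2E d := (memLp_mod ω (Lp.memLp u)).toLp _

lemma Mod_coe (ω : Euc d) (u : L2E d) : ModE ω u =ᵐ[volume] fun t => e2 (dotE ω t) * u t :=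
  MemLp.coeFn_toLp _

lemma norm_Mod_sub (ω : Euc d) (u v : L2E d) : ‖ModE ω u - ModE ω v‖ = ‖u - v‖ := by
  rw [Lp.norm_def, Lp.norm_def]
  congr 1
  apply eLpNorm_congr_norm_ae
  filter_upwards [Mod_coe ω u, Mod_coe ω v, Lp.coeFn_sub u v, Lp.coeFn_sub (ModE ω u) (ModE ω v)]
    with t h1 h2 h3 h4
  rw [h3, h4, Pi.sub_apply, Pi.sub_apply, h1, h2, ← mul_sub, norm_mul, norm_e2, one_mul]

lemma continuous_Mod_left (u : L2E d) : Continuous fun ω => ModE ω u := by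
  rw [continuous_iff_continuousAt]
  intro ω₀
  rw [ContinuousAt, tendsto_iff_norm_sub_tendsto_zero]
  have key : ∀ ω, ‖ModE ω u - ModE ω₀ u‖ ^ 2
      = ∫ t, ‖e2 (dotE ω t) - e2 (dotE ω₀ t)‖ ^ 2 * ‖u t‖ ^ 2 := by
    intro ω
    rw [norm_sq_L2]
    apply integral_congr_ae
    filter_upwards [Mod_coe ω u, Mod_coe ω₀ u, Lp.coeFn_sub (ModE ω u) (ModE ω₀ u)] with t h1 h2 h3
    rw [h3, Pi.sub_apply, h1, h2, ← sub_mul, norm_mul, mul_pow]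
  have hu : Integrable (fun t => ‖u t‖ ^ 2) :=
    (memLp_two_iff_integrable_sq_norm (Lp.aestronglyMeasurable u)).1 (Lp.memLp u)
  have hlim : Tendsto (fun ω => ∫ t, ‖e2 (dotE ω t) - e2 (dotE ω₀ t)‖ ^ 2 * ‖u t‖ ^ 2)
      (nhds ω₀) (nhds (∫ t : Euc d, (0 : ℝ))) := by
    refine tendsto_integral_filter_of_dominated_convergence (fun t => 4 * ‖u t‖ ^ 2) ?_ ?_
      (hu.const_mul 4) ?_
    · filter_upwards with ω
      exact (((continuous_e2_dot ω).sub (continuous_e2_dot ω₀)).norm.pow 2).aestronglyMeasurable.mul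
        hu.1
    · filter_upwards with ω
      filter_upwards with t
      rw [Real.norm_of_nonneg (by positivity)]
      gcongr
      have : ‖e2 (dotE ω t) - e2 (dotE ω₀ t)‖ ≤ 2 := by
        refine (norm_sub_le _ _).trans ?_
        rw [norm_e2, norm_e2]; norm_num
      nlinarith [norm_nonneg (e2 (dotE ω t) - e2 (dotE ω₀ t))]
    · filter_upwards with t
      have hc : Continuous fun ω => ‖e2 (dotE ω t) - e2 (dotE ω₀ t)‖ ^ 2 * ‖u t‖ ^ 2 := by
        have : Continuous fun ω => e2 (dotE ω t) :=
          continuous_e2.comp (continuous_dotE.comp (by fun_prop : Continuous fun ω : Euc d => (ω, t)))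
        fun_prop
      have := hc.tendsto ω₀
      simpa using this
  rw [integral_zero] at hlim
  have h2 := hlim.sqrt
  rw [Real.sqrt_zero] at h2
  refine h2.congr fun ω => ?_
  rw [← key, Real.sqrt_sq (norm_nonneg _)]

/-- Time-frequency shift on `L²`. -/
def Uop (z : ι2 d → ℝ) (u : L2E d) : L2E d :=
  ModE (wpart z) ((DomAddAct.mk (-(xpart z)) : (Euc d)ᵈᵃᵃ) +ᵥ u)

lemma Uop_coe (z : ι2 d → ℝ) (u : L2E d) : Uop z u =ᵐ[volume] tfs z u := by
  filter_upwards [Mod_coe (wpart z) ((DomAddAct.mk (-(xpart z)) : (Euc d)ᵈᵃᵃ) +ᵥ u),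
    DomAddAct.vadd_Lp_ae_eq (DomAddAct.mk (-(xpart z)) : (Euc d)ᵈᵃᵃ) u] with t h1 h2
  rw [Uop, h1, h2, tfs]
  congr 2
  simp [sub_eq_neg_add]

lemma norm_Uop (z : ι2 d → ℝ) (u : L2E d) : ‖Uop z u‖ = ‖u‖ := by
  have h0 : ∀ ω : Euc d, ModE ω (0 : L2E d) = 0 := by
    intro ω
    apply Lp.ext
    filter_upwards [Mod_coe ω (0 : L2E d), Lp.coeFn_zero ℂ 2 (volume : Measure (Euc d))] with t h1 h2
    rw [h1, h2]; simp
  have := norm_Mod_sub (wpart z) ((DomAddAct.mk (-(xpart z)) : (Euc d)ᵈᵃᵃ) +ᵥ u) 0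
  rw [h0, sub_zero, sub_zero] at this
  rw [Uop, this, DomAddAct.norm_vadd_Lp]

lemma continuous_Uop (u : L2E d) : Continuous fun z => Uop z u := by
  have hT : Continuous fun z : ι2 d → ℝ => (DomAddAct.mk (-(xpart z)) : (Euc d)ᵈᵃᵃ) +ᵥ u := by
    have : Continuous fun z : ι2 d → ℝ => (DomAddAct.mk (-(xpart z)) : (Euc d)ᵈᵃᵃ) :=
      DomAddAct.continuous_mk.comp continuous_xpart.neg
    have hfact : Fact ((2 : ℝ≥0∞) ≠ ∞) := ⟨by norm_num⟩
    exact this.vadd continuous_const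
  rw [continuous_iff_continuousAt]
  intro z₀
  rw [ContinuousAt, tendsto_iff_norm_sub_tendsto_zero]
  set T : (ι2 d → ℝ) → L2E d := fun z => (DomAddAct.mk (-(xpart z)) : (Euc d)ᵈᵃᵃ) +ᵥ u with hTdef
  have h1 : Tendsto (fun z => ‖T z - T z₀‖) (nhds z₀) (nhds 0) :=
    tendsto_iff_norm_sub_tendsto_zero.1 (hT.tendsto z₀)
  have h2 : Tendsto (fun z => ‖ModE (wpart z) (T z₀) - ModE (wpart z₀) (T z₀)‖) (nhds z₀) (nhds 0) :=
    tendsto_iff_norm_sub_tendsto_zero.1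
      (((continuous_Mod_left (T z₀)).comp continuous_wpart).tendsto z₀)
  have h3 := h1.add h2
  rw [add_zero] at h3
  refine squeeze_zero (fun _ => norm_nonneg _) (fun z => ?_) h3
  have : Uop z u - Uop z₀ u = (ModE (wpart z) (T z) - ModE (wpart z) (T z₀))
      + (ModE (wpart z) (T z₀) - ModE (wpart z₀) (T z₀)) := by
    simp [Uop, T]
  rw [this]
  refine (norm_add_le _ _).trans ?_
  rw [norm_Mod_sub]

/-- The Gabor coefficient. -/
def cf (g : Euc d → ℂ) (z : ι2 d → ℝ) (f : Euc d → ℂ) : ℂ :=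
  ∫ t : Euc d, f t * (starRingEnd ℂ) (tfs z g t)

lemma cf_eq_inner {g : Euc d → ℂ} (hg : MemLp g 2) (z : ι2 d → ℝ) (f : L2E d) :
    cf g z f = inner ℂ (Uop z (hg.toLp g)) f := by
  rw [L2.inner_def, cf]
  apply integral_congr_ae
  have h := (measurePreserving_sub_right volume (xpart z)).quasiMeasurePreserving.ae_eq_comp
    hg.coeFn_toLp
  filter_upwards [Uop_coe z (hg.toLp g), h] with t h1 h2
  simp only [Function.comp] at h2
  rw [h1, tfs, tfs, h2]; simp

lemma continuous_cf {g : Euc d → ℂ} (hg : MemLp g 2) (f : L2E d) :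
    Continuous fun z => cf g z f := by
  simp only [cf_eq_inner hg]
  exact (continuous_Uop _).inner continuous_const

lemma norm_cf_shift (g : Euc d → ℂ) (z w : ι2 d → ℝ) (f : L2E d) :
    ‖cf g (z + w) (Uop w f)‖ = ‖cf g z f‖ := by
  have h1 : cf g (z + w) (Uop w f)
      = ∫ t, (starRingEnd ℂ) (e2 (dotE (wpart z) (xpart w))) *
        (f (t - xpart w) * (starRingEnd ℂ) (tfs z g (t - xpart w))) := by
    apply integral_congr_ae
    filter_upwards [Uop_coe w f] with t ht
    rw [ht]
    simp only [tfs]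
    rw [wpart_add, xpart_add, dotE_add_left, e2_add, dotE_sub_right,
      sub_eq_add_neg (dotE (wpart z) t), e2_add (dotE (wpart z) t) (-_), ← conj_e2,
      sub_sub, add_comm (xpart w) (xpart z)]
    simp only [map_mul, Complex.conj_conj]
    linear_combination (f (t - xpart w) * (starRingEnd ℂ) (e2 (dotE (wpart z) t)) *
      (starRingEnd ℂ) (g (t - (xpart z + xpart w)))) * (e2_mul_conj (dotE (wpart w) t)
        - e2_mul_conj (dotE (wpart z) (xpart w)))
  rw [h1, integral_const_mul, norm_mul, RCLike.norm_conj, norm_e2, one_mul,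
    integral_sub_right_eq_self (fun t => f t * (starRingEnd ℂ) (tfs z g t)), cf]

end TF

section FT
variable {d : ℕ}
open scoped FourierTransform

/-- The windowed function. -/
def hwin (f g : Euc d → ℂ) (x t : Euc d) : ℂ := f t * (starRingEnd ℂ) (g (t - x))

lemma fourier_e2 (h : Euc d → ℂ) (ω : Euc d) : 𝓕 h ω = ∫ t, e2 (-(dotE ω t)) * h t := by
  rw [Real.fourier_eq']
  apply integral_congr_ae
  filter_upwards with t
  rw [smul_eq_mul, e2, dotE_comm, dotE_eq_inner]
  congr 2
  push_cast; ring

lemma cf_fourier (f g : Euc d → ℂ) (z : ι2 d → ℝ) :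
    cf g z f = 𝓕 (hwin f g (xpart z)) (wpart z) := by
  rw [fourier_e2, cf]
  apply integral_congr_ae
  filter_upwards with t
  simp only [tfs, hwin, map_mul, conj_e2]
  ring

lemma fourier_shift (h : Euc d → ℂ) (b ω : Euc d) :
    𝓕 (fun t => h (t - b)) ω = e2 (-(dotE b ω)) * 𝓕 h ω := by
  rw [fourier_e2, fourier_e2, ← integral_const_mul,
    ← integral_sub_right_eq_self (fun t => e2 (-(dotE b ω)) * (e2 (-(dotE ω t)) * h t)) b]
  apply integral_congr_ae
  filter_upwards with t
  rw [← mul_assoc, ← e2_add, dotE_sub_right, dotE_comm b ω]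
  congr 2; ring

lemma hwin_int {f g : Euc d → ℂ} (hf : MemLp f 2) (hg : MemLp g 2) (x : Euc d) :
    Integrable (hwin f g x) :=
  hf.integrable_mul (memLp_tr x hg).star

lemma hwin_memLp {f g : Euc d → ℂ} (hf : MemLp f 2) (hg : MemLp g 2) {M : ℝ}
    (hM : ∀ᵐ t : Euc d, ‖g t‖ ≤ M) (x : Euc d) : MemLp (hwin f g x) 2 := by
  have hM' : ∀ᵐ t : Euc d, ‖g (t - x)‖ ≤ M :=
    (measurePreserving_sub_right volume x).quasiMeasurePreserving.ae hM
  refine (hf.norm.const_mul M).of_le (hwin_int hf hg x).1 ?_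
  filter_upwards [hM'] with t ht
  have hM0 : 0 ≤ M := (norm_nonneg _).trans ht
  rw [hwin, norm_mul, RCLike.norm_conj, norm_mul, norm_norm, Real.norm_of_nonneg hM0, mul_comm]
  gcongr

lemma sq_fourier {h : Euc d → ℂ} (h1 : Integrable h) (h2 : MemLp h 2) (b : Euc d) :
    ∫ ω, ((‖𝓕 h ω‖ ^ 2 : ℝ) : ℂ) * e2 (-(dotE b ω)) = ∫ t, h (t - b) * (starRingEnd ℂ) (h t) := by
  rw [← parseval (h1.comp_sub_right b) (memLp_tr b h2) h1 h2]
  apply integral_congr_ae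
  filter_upwards with ω
  rw [fourier_shift, mul_assoc, Complex.mul_conj, Complex.normSq_eq_norm_sq, mul_comm]

/-- Splitting phase space. -/
def splitP (d : ℕ) : (ι2 d → ℝ) ≃ᵐ Euc d × Euc d :=
  (MeasurableEquiv.sumPiEquivProdPi (fun _ : ι2 d => ℝ)).trans
    (MeasurableEquiv.prodCongr (MeasurableEquiv.toLp 2 _) (MeasurableEquiv.toLp 2 _))

lemma splitP_apply (z : ι2 d → ℝ) : splitP d z = (xpart z, wpart z) := rfl

lemma splitP_mp : MeasurePreserving (splitP d) := by
  have h1 := volume_measurePreserving_sumPiEquivProdPi (fun _ : ι2 d => ℝ)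
  have h2 := (PiLp.volume_preserving_toLp (Fin d)).prod (PiLp.volume_preserving_toLp (Fin d))
  exact h2.comp h1

lemma int_sq {f : Euc d → ℂ} (hf : MemLp f 2) : Integrable fun t => ‖f t‖ ^ 2 :=
  (memLp_two_iff_integrable_sq_norm hf.1).1 hf

lemma conv_aux {E' : Type*} [RCLike E'] {φ ψ : Euc d → E'} (hφ : Integrable φ) (hψ : Integrable ψ) :
    Integrable (fun x => ∫ t, φ t * ψ (t - x)) ∧
      ∫ x, ∫ t, φ t * ψ (t - x) = (∫ t, φ t) * ∫ t, ψ t := by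
  have h1 := hφ.integrable_convolution (ContinuousLinearMap.mul ℝ E') hψ.comp_neg
  have h2 := integral_convolution (μ := (volume : Measure (Euc d))) (ν := (volume : Measure (Euc d)))
    (ContinuousLinearMap.mul ℝ E') hφ hψ.comp_neg
  have e : (convolution φ (fun t => ψ (-t)) (ContinuousLinearMap.mul ℝ E') volume)
      = fun x => ∫ t, φ t * ψ (t - x) := by
    funext x
    simp [convolution_def]
  rw [e] at h1 h2
  refine ⟨h1, h2.trans ?_⟩
  rw [integral_neg_eq_self ψ]
  rfl

lemma ft_cf {f : L2E d} {g : Euc d → ℂ} (hg : MemLp g 2) {M : ℝ}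
    (hM : ∀ᵐ t : Euc d, ‖g t‖ ≤ M) (a b : Euc d) :
    Integrable (fun z => ‖cf g z f‖ ^ 2) ∧
    ∫ z, ((‖cf g z f‖ ^ 2 : ℝ) : ℂ) * e2 (-(dotE a (xpart z) + dotE b (wpart z)))
      = STFT g g b (-a) * (starRingEnd ℂ) (STFT f f b (-a)) := by
  have hf := Lp.memLp f
  set F : Euc d × Euc d → ℝ := fun p => ‖𝓕 (hwin f g p.1) p.2‖ ^ 2 with hF
  have hFz : ∀ z, ‖cf g z f‖ ^ 2 = F (splitP d z) := fun z => by
    rw [cf_fourier, splitP_apply]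
  have hFm : Measurable F := by
    have h1 : Measurable fun z => ‖cf g z f‖ ^ 2 :=
      ((continuous_cf hg f).norm.pow 2).measurable
    have h2 := h1.comp (splitP d).symm.measurable
    convert h2 using 1
    funext p
    simp [hFz]
  have key0 : ∀ x, ∫ ω, F (x, ω) = ∫ t, ‖f t‖ ^ 2 * ‖g (t - x)‖ ^ 2 := by
    intro x
    have h := sq_fourier (hwin_int hf hg x) (hwin_memLp hf hg hM x) 0
    have e1 : ∀ ω : Euc d, e2 (-(dotE 0 ω)) = 1 := fun ω => by simp [dotE, e2_zero]
    simp only [e1, mul_one, sub_zero, Complex.mul_conj, Complex.normSq_eq_norm_sq] at h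
    rw [integral_complex_ofReal, integral_complex_ofReal] at h
    have h' := Complex.ofReal_injective h
    refine h'.trans (integral_congr_ae ?_)
    filter_upwards with t
    rw [hwin, norm_mul, RCLike.norm_conj, mul_pow]
  have hFi : Integrable F := by
    refine (integrable_prod_iff hFm.aestronglyMeasurable).2 ⟨?_, ?_⟩
    · filter_upwards with x
      exact int_sq (memLp_fourier (hwin_int hf hg x) (hwin_memLp hf hg hM x))
    · have e : (fun x => ∫ ω, ‖F (x, ω)‖) = fun x => ∫ t, ‖f t‖ ^ 2 * ‖g (t - x)‖ ^ 2 := by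
        funext x
        rw [← key0]
        apply integral_congr_ae
        filter_upwards with ω
        rw [Real.norm_of_nonneg (by positivity)]
      rw [e]
      exact (conv_aux (int_sq hf) (int_sq hg)).1
  constructor
  · simp only [hFz]
    exact splitP_mp.integrable_comp_of_integrable hFi
  set K : Euc d × Euc d → ℂ := fun p => (F p : ℂ) * e2 (-(dotE a p.1 + dotE b p.2)) with hK
  have hKi : Integrable K := by
    refine hFi.ofReal.mul_bdd (c := 1) ?_ ?_
    · refine (continuous_e2.comp ?_).aestronglyMeasurable
      have h1 : Continuous fun p : Euc d × Euc d => dotE a p.1 :=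
        continuous_dotE.comp (by fun_prop : Continuous fun p : Euc d × Euc d => (a, p.1))
      have h2 : Continuous fun p : Euc d × Euc d => dotE b p.2 :=
        continuous_dotE.comp (by fun_prop : Continuous fun p : Euc d × Euc d => (b, p.2))
      fun_prop
    · filter_upwards with p
      rw [norm_e2]
  have e1 : ∫ z, ((‖cf g z f‖ ^ 2 : ℝ) : ℂ) * e2 (-(dotE a (xpart z) + dotE b (wpart z)))
      = ∫ p, K p := by
    rw [← splitP_mp.integral_comp' K]
    simp only [hFz, hK, splitP_apply]
  rw [e1, Measure.volume_eq_prod, integral_prod _ hKi]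
  set φ : Euc d → ℂ := fun t => f (t - b) * (starRingEnd ℂ) (f t) * e2 (-(dotE a t)) with hφ
  set ψ : Euc d → ℂ := fun t => g t * (starRingEnd ℂ) (g (t - b)) * e2 (dotE a t) with hψ
  have e2' : ∀ x, ∫ ω, K (x, ω) = ∫ t, φ t * ψ (t - x) := by
    intro x
    have h := sq_fourier (hwin_int hf hg x) (hwin_memLp hf hg hM x) b
    have : ∀ ω, K (x, ω) = e2 (-(dotE a x)) * (((‖𝓕 (hwin f g x) ω‖ ^ 2 : ℝ) : ℂ) * e2 (-(dotE b ω))) := by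
      intro ω
      simp only [hK, hF]
      rw [neg_add, e2_add]; ring
    simp only [this]
    rw [integral_const_mul, h, ← integral_const_mul]
    apply integral_congr_ae
    filter_upwards with t
    have h3 : e2 (-(dotE a x)) = e2 (-(dotE a t)) * e2 (dotE a (t - x)) := by
      rw [← e2_add, dotE_sub_right]; congr 1; ring
    simp only [hφ, hψ, hwin, map_mul, Complex.conj_conj]
    rw [h3, sub_right_comm t b x]
    ring
  simp only [e2']
  have hb : ∀ c : Euc d, Continuous fun t => e2 (dotE c t) := continuous_e2_dot
  have hφi : Integrable φ := by
    refine Integrable.mul_bdd (c := 1) ((memLp_tr b hf).integrable_mul hf.star) ?_ ?_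
    · have := hb (-a)
      simp only [dotE_neg_left] at this
      exact this.aestronglyMeasurable
    · filter_upwards with p
      rw [norm_e2]
  have hψi : Integrable ψ := by
    refine Integrable.mul_bdd (c := 1) (hg.integrable_mul (memLp_tr b hg).star) ?_ ?_
    · exact (hb a).aestronglyMeasurable
    · filter_upwards with p
      rw [norm_e2]
  rw [(conv_aux hφi hψi).2, mul_comm]
  congr 1
  · rw [STFT]
    apply integral_congr_ae
    filter_upwards with t
    simp only [hψ, dotE_neg_left, neg_neg]; ring
  · rw [STFT, ← integral_conj]
    apply integral_congr_ae
    filter_upwards with t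
    simp only [hφ, dotE_neg_left, neg_neg, map_mul, conj_e2, Complex.conj_conj]; ring

end FT


set_option linter.unusedSectionVars false
section Poisson
open UnitAddTorus

variable {ι : Type*} [Fintype ι]

/-- The normalized Haar measure on the torus. -/
def muT (ι : Type*) [Fintype ι] : Measure (UnitAddTorus ι) :=
  Measure.pi fun _ => AddCircle.haarAddCircle

/-- The covering map. -/
def qT (w : ι → ℝ) : UnitAddTorus ι := fun i => (w i : UnitAddCircle)

/-- Fundamental cube centered at `0`. -/
def cubeT (ι : Type*) : Set (ι → ℝ) := {x | ∀ i, x i ∈ Set.Ioc (-(1/2) : ℝ) (-(1/2) + 1)}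

/-- The section of the covering map. -/
def rT (θ : UnitAddTorus ι) : ι → ℝ := (measurableEquivPiIoc (fun _ => (-(1/2) : ℝ)) θ).1

instance : IsProbabilityMeasure (muT ι) := by unfold muT; infer_instance

lemma measurable_qT : Measurable (qT (ι := ι)) :=
  measurable_pi_lambda _ fun i => AddCircle.measurable_mk'.comp (measurable_pi_apply i)

lemma continuous_qT : Continuous (qT (ι := ι)) :=
  continuous_pi fun i => (AddCircle.continuous_mk' 1).comp (continuous_apply i)

lemma measurable_rT : Measurable (rT (ι := ι)) :=
  measurable_subtype_coe.comp (MeasurableEquiv.measurable _)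

lemma measurableSet_cubeT : MeasurableSet (cubeT ι) :=
  MeasurableSet.univ_pi' (fun i => measurableSet_Ioc)

lemma rT_qT {w : ι → ℝ} (hw : w ∈ cubeT ι) : rT (qT w) = w := by
  have : qT w = (measurableEquivPiIoc (fun _ => (-(1/2) : ℝ))).symm ⟨w, hw⟩ := rfl
  rw [rT, this, MeasurableEquiv.apply_symm_apply]

lemma lintegral_muT (f : UnitAddTorus ι → ℝ≥0∞) :
    ∫⁻ x, f x ∂(muT ι) = ∫⁻ w in cubeT ι, f (qT w) :=
  lintegral_preimage f (fun _ => -(1/2))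

lemma map_qT : Measure.map qT (volume.restrict (cubeT ι)) = muT ι := by
  ext s hs
  rw [← lintegral_indicator_one hs, ← lintegral_indicator_one hs, lintegral_muT,
    lintegral_map (measurable_one.indicator hs) measurable_qT]

lemma lintegral_tile (F : (ι → ℝ) → ℝ≥0∞) (hF : Measurable F) :
    ∫⁻ w, F w = ∑' κ : ι → ℤ, ∫⁻ w in cubeT ι, F (w + fun i => (κ i : ℝ)) := by
  let D : (ι → ℤ) → Set (ι → ℝ) := fun κ =>
    {x | ∀ i, x i ∈ Set.Ioc (-(1/2) + (κ i : ℝ)) (-(1/2) + (κ i : ℝ) + 1)}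
  have hD : ∀ κ, MeasurableSet (D κ) := fun κ =>
    MeasurableSet.univ_pi' (fun i => measurableSet_Ioc)
  have hU : (⋃ κ, D κ) = Set.univ := by
    rw [Set.eq_univ_iff_forall]
    intro x
    have : ∀ i, ∃ n : ℤ, x i ∈ Set.Ioc (-(1/2) + (n : ℝ)) (-(1/2) + (n : ℝ) + 1) := by
      intro i
      have := Set.mem_univ (x i)
      rw [← iUnion_Ioc_add_intCast (-(1/2) : ℝ)] at this
      simpa only [Set.mem_iUnion] using this
    choose n hn using this
    exact Set.mem_iUnion.2 ⟨n, hn⟩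
  have hdis : Pairwise (Function.onFun Disjoint D) := by
    intro κ κ' h
    obtain ⟨i, hi⟩ := Function.ne_iff.mp h
    have := Set.pairwise_disjoint_Ioc_add_intCast (-(1/2) : ℝ) hi
    rw [Function.onFun, Set.disjoint_left] at this ⊢
    intro x hx hx'
    exact this (hx i) (hx' i)
  rw [← setLIntegral_univ, ← hU, lintegral_iUnion hD hdis]
  congr 1; ext κ
  rw [← (measurePreserving_add_right volume (fun i => (κ i : ℝ))).setLIntegral_comp_preimage (hD κ) hF]
  congr 2
  ext x
  simp only [D, cubeT, Set.mem_preimage, Set.mem_ofPred_eq, Set.mem_Ioc, Pi.add_apply]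
  refine forall_congr' fun i => ?_
  constructor <;> rintro ⟨h1, h2⟩ <;> constructor <;> linarith

lemma mFourier_qT (k : ι → ℤ) (w : ι → ℝ) :
    mFourier k (qT w) = e2 (∑ i, (k i : ℝ) * w i) := by
  simp only [mFourier, qT, ContinuousMap.coe_mk, fourier_coe_apply, e2]
  rw [← Complex.exp_sum]
  congr 1
  push_cast
  rw [Finset.mul_sum]
  refine Finset.sum_congr rfl fun i _ => ?_
  simp; ring

lemma integral_mFourier (n : ι → ℤ) :
    ∫ θ, mFourier n θ ∂(muT ι) = if n = 0 then 1 else 0 := by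
  have h := orthonormal_iff_ite.mp (orthonormal_mFourier (d := ι)) 0 n
  simp only [ContinuousMap.inner_toLp] at h
  simp only [mFourier_zero, ContinuousMap.one_apply, map_one, mul_one, eq_comm (a := (0 : ι → ℤ))] at h
  exact h

lemma continuous_integral_T (P : Measure (UnitAddTorus ι)) [IsFiniteMeasure P] :
    Continuous fun φ : C(UnitAddTorus ι, ℂ) => ∫ θ, φ θ ∂P := by
  apply LipschitzWith.continuous (K := (P.real Set.univ).toNNReal)
  refine LipschitzWith.of_dist_le_mul fun φ ψ => ?_
  have hi : ∀ φ : C(UnitAddTorus ι, ℂ), Integrable (fun θ => φ θ) P := fun φ =>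
    φ.continuous.integrable_of_hasCompactSupport (HasCompactSupport.of_compactSpace _)
  rw [dist_eq_norm, dist_eq_norm, ← integral_sub (hi _) (hi _), Real.coe_toNNReal _ measureReal_nonneg,
    mul_comm]
  apply norm_integral_le_of_norm_le_const
  filter_upwards with θ
  exact (φ - ψ).norm_coe_le_norm θ

lemma measure_ext_T (P P' : Measure (UnitAddTorus ι)) [IsFiniteMeasure P] [IsFiniteMeasure P']
    (h : ∀ k : ι → ℤ, ∫ θ, mFourier k θ ∂P = ∫ θ, mFourier k θ ∂P') : P = P' := by
  have hi : ∀ (P : Measure (UnitAddTorus ι)) [IsFiniteMeasure P] (φ : C(UnitAddTorus ι, ℂ)),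
      Integrable (fun θ => φ θ) P := fun P _ φ =>
    φ.continuous.integrable_of_hasCompactSupport (HasCompactSupport.of_compactSpace _)
  have key : ∀ φ : C(UnitAddTorus ι, ℂ), ∫ θ, φ θ ∂P = ∫ θ, φ θ ∂P' := by
    intro φ
    have hφ : φ ∈ closure ((Submodule.span ℂ (Set.range (mFourier (d := ι))) : Submodule ℂ _) :
        Set C(UnitAddTorus ι, ℂ)) := by
      rw [← Submodule.topologicalClosure_coe, span_mFourier_closure_eq_top]; trivial
    refine closure_minimal (t := {φ | ∫ θ, φ θ ∂P = ∫ θ, φ θ ∂P'}) ?_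
      (isClosed_eq (continuous_integral_T P) (continuous_integral_T P')) hφ
    intro ψ hψ
    induction hψ using Submodule.span_induction with
    | mem x hx => obtain ⟨k, rfl⟩ := hx; exact h k
    | zero => simp
    | add x y _ _ hx hy =>
      simp only [Set.mem_ofPred_eq, ContinuousMap.add_apply] at hx hy ⊢
      rw [integral_add (hi _ _) (hi _ _), integral_add (hi _ _) (hi _ _), hx, hy]
    | smul a x _ hx =>
      simp only [Set.mem_ofPred_eq, ContinuousMap.smul_apply] at hx ⊢
      rw [integral_smul, integral_smul, hx]
  apply ext_of_forall_integral_eq_of_IsFiniteMeasure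
  intro f
  have := key ⟨fun θ => (f θ : ℂ), Complex.continuous_ofReal.comp f.continuous⟩
  simp only [ContinuousMap.coe_mk] at this
  rw [integral_complex_ofReal, integral_complex_ofReal] at this
  exact_mod_cast this




lemma poisson_frequently (H : (ι → ℝ) → ℝ) (H0 : ∀ w, 0 ≤ H w) (Hc : Continuous H)
    (Hi : Integrable H) (c : (ι → ℤ) → ℂ)
    (hc : ∀ k, ∫ w, (H w : ℂ) * e2 (-(∑ i, (k i : ℝ) * w i)) = c k)
    (hs : Summable fun k => ‖c k‖) :
    ∃ᶠ w in nhds (0 : ι → ℝ), HasSum (fun κ : ι → ℤ => H (w + fun i => (κ i : ℝ)))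
      (∑' k, c k * e2 (∑ i, (k i : ℝ) * w i)).re := by
  have hsum : Summable fun k => c k • mFourier (d := ι) k := by
    apply Summable.of_norm
    simpa [norm_smul, mFourier_norm] using hs
  let Q : C(UnitAddTorus ι, ℂ) := ∑' k, c k • mFourier k
  have hQ : HasSum (fun k => c k • mFourier k) Q := hsum.hasSum
  have hQθ : ∀ θ, HasSum (fun k => c k * mFourier k θ) (Q θ) := fun θ => by
    simpa using ContinuousMap.hasSum_apply hQ θ
  have hcc : ∀ k, (starRingEnd ℂ) (c k) = c (-k) := by
    intro k
    rw [← hc, ← hc, ← integral_conj]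
    congr 1; ext w
    simp only [map_mul, Complex.conj_ofReal, conj_e2]
    simp
  have hQreal : ∀ θ, (((Q θ).re : ℝ) : ℂ) = Q θ := by
    intro θ
    rw [← Complex.conj_eq_iff_re]
    have h1 : HasSum (fun k => (starRingEnd ℂ) (c k * mFourier k θ)) ((starRingEnd ℂ) (Q θ)) :=
      (hQθ θ).map (starRingEnd ℂ) Complex.continuous_conj
    have h2 : HasSum (fun k => c (-k) * mFourier (-k) θ) (Q θ) :=
      (Equiv.neg (ι → ℤ)).hasSum_iff.2 (hQθ θ)
    refine h1.unique ?_
    convert h2 using 2 with k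
    rw [map_mul, hcc, mFourier_neg]
  have hQcoef : ∀ k, ∫ θ, mFourier k θ * Q θ ∂(muT ι) = c (-k) := by
    intro k
    have h1 := hQ.mul_left (mFourier k)
    have h2 := h1.map (⟨⟨fun φ => ∫ θ, φ θ ∂(muT ι), by simp⟩, fun φ ψ => by
        simp only [ContinuousMap.add_apply]
        exact integral_add (φ.continuous.integrable_of_hasCompactSupport (HasCompactSupport.of_compactSpace _))
          (ψ.continuous.integrable_of_hasCompactSupport (HasCompactSupport.of_compactSpace _))⟩ : C(UnitAddTorus ι, ℂ) →+ ℂ)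
      (continuous_integral_T (muT ι))
    refine h2.unique ?_
    convert hasSum_ite_eq (-k) (c (-k)) using 1
    ext j
    simp only [Function.comp, AddMonoidHom.coe_mk, ZeroHom.coe_mk, ContinuousMap.mul_apply,
      ContinuousMap.smul_apply, smul_eq_mul]
    have : ∀ θ, mFourier k θ * (c j * mFourier j θ) = c j * mFourier (k + j) θ := fun θ => by
      rw [mFourier_add]; ring
    simp only [this]
    rw [integral_const_mul, integral_mFourier]
    by_cases hj : j = -k
    · simp [hj]
    · have : k + j ≠ 0 := fun h => hj (eq_neg_of_add_eq_zero_right h)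
      simp [hj, this]
  -- the measures
  let M : ℝ := ‖Q‖
  have hM : ∀ θ, 0 ≤ (Q θ).re + M := fun θ => by
    have := (abs_le.1 ((Complex.abs_re_le_norm (Q θ)).trans (Q.norm_coe_le_norm θ))).1
    simp only [M]; linarith
  let Per : (ι → ℝ) → ℝ≥0∞ := fun w => ∑' κ : ι → ℤ, ENNReal.ofReal (H (w + fun i => (κ i : ℝ)))
  have hPer : Measurable Per := by
    apply Measurable.tsum
    intro κ
    exact (Hc.comp (by fun_prop)).measurable.ennreal_ofReal
  have hQc : Continuous fun θ => (Q θ).re := Complex.continuous_re.comp Q.continuous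
  have hQm : Measurable fun θ => ENNReal.ofReal ((Q θ).re + M) :=
    (hQc.add continuous_const).measurable.ennreal_ofReal
  let ν : Measure (UnitAddTorus ι) := Measure.map qT (volume.withDensity fun w => ENNReal.ofReal (H w))
  have hνd : ν = (muT ι).withDensity (fun θ => Per (rT θ)) := by
    ext s hs
    rw [Measure.map_apply measurable_qT hs, withDensity_apply _ (measurable_qT hs),
      withDensity_apply _ hs, ← lintegral_indicator (measurable_qT hs), ← lintegral_indicator hs,
      lintegral_muT, lintegral_tile _ (Hc.measurable.ennreal_ofReal.indicator (measurable_qT hs))]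
    rw [← lintegral_tsum]
    · refine setLIntegral_congr_fun measurableSet_cubeT fun w hw => ?_
      have hper : ∀ κ : ι → ℤ, qT (w + fun i => (κ i : ℝ)) = qT w := by
        intro κ
        ext i
        simp only [qT, Pi.add_apply]
        rw [AddCircle.coe_add]
        have : ((κ i : ℝ) : UnitAddCircle) = 0 := by
          rw [AddCircle.coe_eq_zero_iff]
          exact ⟨κ i, by simp⟩
        rw [this, add_zero]
      by_cases hmem : qT w ∈ s
      · simp [Set.indicator, hper, hmem, rT_qT hw, Per]
      · simp [Set.indicator, hper, hmem]
    · intro κ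
      apply Measurable.aemeasurable
      exact (Hc.measurable.ennreal_ofReal.indicator (measurable_qT hs)).comp (by fun_prop)
  have : IsFiniteMeasure (volume.withDensity fun w => ENNReal.ofReal (H w)) :=
    isFiniteMeasure_withDensity_ofReal Hi.2
  have : IsFiniteMeasure ν := by infer_instance
  have hQint : Integrable (fun θ => (Q θ).re + M) (muT ι) :=
    (hQc.add continuous_const).integrable_of_hasCompactSupport (HasCompactSupport.of_compactSpace _)
  have : IsFiniteMeasure ((muT ι).withDensity fun θ => ENNReal.ofReal ((Q θ).re + M)) :=
    isFiniteMeasure_withDensity_ofReal hQint.2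
  have hPint : ∀ (P : Measure (UnitAddTorus ι)) [IsFiniteMeasure P] (φ : C(UnitAddTorus ι, ℂ)),
      Integrable (fun θ => φ θ) P := fun P _ φ =>
    φ.continuous.integrable_of_hasCompactSupport (HasCompactSupport.of_compactSpace _)
  have hmeas : ν + (M.toNNReal) • (muT ι)
      = (muT ι).withDensity fun θ => ENNReal.ofReal ((Q θ).re + M) := by
    apply measure_ext_T
    intro k
    rw [integral_add_measure (hPint _ _) (hPint _ _)]
    have e1 : ∫ θ, mFourier k θ ∂ν = c (-k) := by
      rw [integral_map measurable_qT.aemeasurable (mFourier k).continuous.aestronglyMeasurable]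
      rw [integral_withDensity_eq_integral_toReal_smul Hc.measurable.ennreal_ofReal (by simp)]
      rw [← hc]
      congr 1; ext w
      rw [ENNReal.toReal_ofReal (H0 w), mFourier_qT]
      simp
    have e3 : ∫ θ, mFourier k θ ∂((muT ι).withDensity fun θ => ENNReal.ofReal ((Q θ).re + M))
        = c (-k) + M * ∫ θ, mFourier k θ ∂(muT ι) := by
      rw [integral_withDensity_eq_integral_toReal_smul
        hQm (by simp), ← hQcoef, ← integral_const_mul,
        ← integral_add (show Integrable (fun θ => mFourier k θ * Q θ) (muT ι) from hPint _ (mFourier k * Q)) ((hPint _ _).const_mul _)]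
      congr 1; ext θ
      rw [ENNReal.toReal_ofReal (hM θ), Complex.real_smul]
      push_cast
      rw [hQreal]; ring
    rw [e1, e3]
    congr 1
    rw [integral_smul_nnreal_measure]
    rw [NNReal.smul_def, Complex.real_smul, Real.coe_toNNReal _ (norm_nonneg Q)]
  have hae : ∀ᵐ θ ∂(muT ι), Per (rT θ) + ENNReal.ofReal M = ENNReal.ofReal ((Q θ).re + M) := by
    rw [hνd] at hmeas
    have : (M.toNNReal) • (muT ι) = (muT ι).withDensity fun _ => ENNReal.ofReal M := by
      rw [withDensity_const]; rfl
    rw [this, ← withDensity_add_right _ measurable_const] at hmeas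
    exact (withDensity_eq_iff_of_sigmaFinite ((hPer.comp measurable_rT).add_const _).aemeasurable
      (hQc.add continuous_const).measurable.ennreal_ofReal.aemeasurable).1 hmeas
  rw [← map_qT] at hae
  have hae2 := ae_of_ae_map measurable_qT.aemeasurable hae
  rw [ae_restrict_iff' measurableSet_cubeT] at hae2
  have hgood : ∀ᵐ w : ι → ℝ, w ∈ cubeT ι → HasSum (fun κ : ι → ℤ => H (w + fun i => (κ i : ℝ)))
      (∑' k, c k * e2 (∑ i, (k i : ℝ) * w i)).re := by
    filter_upwards [hae2] with w hw hwc
    have h := hw hwc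
    rw [rT_qT hwc] at h
    have hQw : ∑' k, c k * e2 (∑ i, (k i : ℝ) * w i) = Q (qT w) := by
      rw [← (hQθ (qT w)).tsum_eq]
      simp only [mFourier_qT]
    rw [hQw]
    have hfin : Per w ≠ ⊤ := by
      intro h'
      rw [h', top_add] at h
      exact ENNReal.ofReal_ne_top h.symm
    have hsm : Summable (fun κ : ι → ℤ => H (w + fun i => (κ i : ℝ))) := by
      have := ENNReal.summable_toReal hfin
      refine this.congr fun κ => ?_
      rw [ENNReal.toReal_ofReal (H0 _)]
    have hP : Per w = ENNReal.ofReal (∑' κ : ι → ℤ, H (w + fun i => (κ i : ℝ))) :=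
      (ENNReal.ofReal_tsum_of_nonneg (fun _ => H0 _) hsm).symm
    rw [hP, ← ENNReal.ofReal_add (tsum_nonneg fun _ => H0 _) (norm_nonneg _),
      ENNReal.ofReal_eq_ofReal_iff (add_nonneg (tsum_nonneg fun _ => H0 _) (norm_nonneg _)) (hM _)] at h
    have : (Q (qT w)).re = ∑' κ : ι → ℤ, H (w + fun i => (κ i : ℝ)) := by linarith
    rw [this]
    exact hsm.hasSum
  have hnh : cubeT ι ∈ nhds (0 : ι → ℝ) := by
    have : cubeT ι = Set.univ.pi fun _ => Set.Ioc (-(1/2) : ℝ) (-(1/2) + 1) := by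
      ext x; simp [cubeT]
    rw [this]
    exact set_pi_mem_nhds Set.finite_univ fun i _ => Ioc_mem_nhds (by norm_num) (by norm_num)
  have hd := (Measure.dense_of_ae hgood)
  rw [frequently_iff]
  intro U hU
  obtain ⟨w, hw1, hw2⟩ := hd.inter_nhds_nonempty (inter_mem hU hnh)
  exact ⟨w, hw2.1, hw1 hw2.2⟩

end Poisson

section Fin
variable {d : ℕ}

lemma Uop_zero (u : L2E d) : Uop 0 u = u := by
  apply Lp.ext
  filter_upwards [Uop_coe 0 u] with t ht
  rw [ht, tfs, xpart_zero, wpart_zero]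
  simp [dotE, e2_zero]

lemma frame_of_frequently {g : Euc d → ℂ} (hg : MemLp g 2) (L : Matrix (ι2 d) (ι2 d) ℝ) (A B : ℝ)
    (hP : ∀ f : L2E d, ∃ᶠ w in nhds (0 : ι2 d → ℝ), ∃ S,
      HasSum (fun κ : ι2 d → ℤ => ‖cf g (L.mulVec (w + fun i => (κ i : ℝ))) f‖ ^ 2) S ∧
        A * ‖f‖ ^ 2 ≤ S ∧ S ≤ B * ‖f‖ ^ 2) (f : L2E d) :
    Summable (fun κ : ι2 d → ℤ => ‖cf g (latV L κ) f‖ ^ 2) ∧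
      A * ‖f‖ ^ 2 ≤ ∑' κ : ι2 d → ℤ, ‖cf g (latV L κ) f‖ ^ 2 ∧
      ∑' κ : ι2 d → ℤ, ‖cf g (latV L κ) f‖ ^ 2 ≤ B * ‖f‖ ^ 2 := by
  have hmul : Continuous fun w : ι2 d → ℝ => L.mulVec w := by
    exact (LinearMap.continuous_of_finiteDimensional (Matrix.toLin' L))
  have upper : ∀ (f : L2E d) (s : Finset (ι2 d → ℤ)),
      ∑ κ ∈ s, ‖cf g (latV L κ) f‖ ^ 2 ≤ B * ‖f‖ ^ 2 := by
    intro f s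
    have hc : Continuous fun w : ι2 d → ℝ =>
        ∑ κ ∈ s, ‖cf g (L.mulVec (w + fun i => (κ i : ℝ))) f‖ ^ 2 := by
      refine continuous_finsetSum _ fun κ _ => ?_
      exact (((continuous_cf hg f).comp (hmul.comp (continuous_id.add continuous_const))).norm.pow 2)
    have ht := hc.tendsto 0
    simp only [zero_add] at ht
    refine le_of_tendsto_of_frequently ht ((hP f).mono ?_)
    rintro w ⟨S, hS, -, h2⟩
    exact (sum_le_hasSum s (fun _ _ => by positivity) hS).trans h2
  have hsm : ∀ f : L2E d, Summable (fun κ : ι2 d → ℤ => ‖cf g (latV L κ) f‖ ^ 2) := fun f =>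
    summable_of_sum_le (fun _ => by positivity) (upper f)
  have hub : ∀ f : L2E d, ∑' κ : ι2 d → ℤ, ‖cf g (latV L κ) f‖ ^ 2 ≤ B * ‖f‖ ^ 2 := fun f =>
    (hsm f).tsum_le_of_sum_le (upper f)
  refine ⟨hsm f, ?_, hub f⟩
  set T := ∑' κ : ι2 d → ℤ, ‖cf g (latV L κ) f‖ ^ 2 with hT
  have hT0 : 0 ≤ T := tsum_nonneg fun _ => by positivity
  have step : ∀ ε : ℝ, 0 < ε → A * ‖f‖ ^ 2 ≤ (1 + ε) * T := by
    intro ε hε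
    have hc : Continuous fun w : ι2 d → ℝ =>
        (1 + ε) * T + (1 + ε⁻¹) * (B * ‖Uop (-(L.mulVec w)) f - f‖ ^ 2) := by
      have := (continuous_Uop f).comp hmul.neg
      simp only [Function.comp_def] at this
      fun_prop
    have ht := hc.tendsto 0
    simp only [Matrix.mulVec_zero, neg_zero, Uop_zero, sub_self, norm_zero] at ht
    have ht' : Tendsto (fun w : ι2 d → ℝ =>
        (1 + ε) * T + (1 + ε⁻¹) * (B * ‖Uop (-(L.mulVec w)) f - f‖ ^ 2)) (nhds 0)
        (nhds ((1 + ε) * T)) := by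
      simpa using ht
    refine ge_of_tendsto_of_frequently ht' ((hP f).mono ?_)
    rintro w ⟨S, hS, h1, -⟩
    refine h1.trans ?_
    set u := Uop (-(L.mulVec w)) f with hu
    have hterm : ∀ κ : ι2 d → ℤ, ‖cf g (L.mulVec (w + fun i => (κ i : ℝ))) f‖ ^ 2
        ≤ (1 + ε) * ‖cf g (latV L κ) f‖ ^ 2 + (1 + ε⁻¹) * ‖cf g (latV L κ) (u - f : L2E d)‖ ^ 2 := by
      intro κ
      rw [← norm_cf_shift g _ (-(L.mulVec w)) f, Matrix.mulVec_add, add_comm (L.mulVec w),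
        add_neg_cancel_right]
      change ‖cf g (latV L κ) u‖ ^ 2 ≤ _
      have hlin : cf g (latV L κ) u = cf g (latV L κ) f + cf g (latV L κ) (u - f : L2E d) := by
        rw [cf_eq_inner hg, cf_eq_inner hg, cf_eq_inner hg, ← inner_add_right, add_sub_cancel]
      rw [hlin]
      set a := cf g (latV L κ) f
      set b := cf g (latV L κ) (u - f : L2E d)
      have h3 := norm_add_le a b
      have h4 : ‖a + b‖ ^ 2 ≤ (‖a‖ + ‖b‖) ^ 2 := by gcongr
      refine h4.trans ?_
      have h5 : (1 + ε) * ‖a‖ ^ 2 + (1 + ε⁻¹) * ‖b‖ ^ 2 - (‖a‖ + ‖b‖) ^ 2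
          = ε⁻¹ * (ε * ‖a‖ - ‖b‖) ^ 2 := by
        field_simp; ring
      have h6 : 0 ≤ ε⁻¹ * (ε * ‖a‖ - ‖b‖) ^ 2 := by positivity
      linarith
    have hsum2 := ((hsm f).hasSum.mul_left (1 + ε)).add ((hsm (u - f)).hasSum.mul_left (1 + ε⁻¹))
    refine (hasSum_le hterm hS hsum2).trans ?_
    have := hub (u - f)
    gcongr
  refine le_of_forall_pos_le_add fun δ hδ => ?_
  refine (step (δ / (T + 1)) (by positivity)).trans ?_
  have : δ / (T + 1) * T ≤ δ := by
    rw [div_mul_eq_mul_div, div_le_iff₀ (by positivity)]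
    nlinarith
  linarith

lemma xpart_dual_neg (L : Matrix (ι2 d) (ι2 d) ℝ) (k : ι2 d → ℤ) :
    xpart (dualV L (-k)) = wpart ((L⁻¹)ᵀ.mulVec fun i => (k i : ℝ)) := by
  have : (fun i => (((-k) i : ℤ) : ℝ)) = -(fun i => (k i : ℝ)) := by ext i; simp
  rw [dualV, this, Matrix.mulVec_neg]
  ext i
  simp [xpart, wpart, Jmap, toE]

lemma wpart_dual_neg (L : Matrix (ι2 d) (ι2 d) ℝ) (k : ι2 d → ℤ) :
    wpart (dualV L (-k)) = -xpart ((L⁻¹)ᵀ.mulVec fun i => (k i : ℝ)) := by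
  have : (fun i => (((-k) i : ℤ) : ℝ)) = -(fun i => (k i : ℝ)) := by ext i; simp
  rw [dualV, this, Matrix.mulVec_neg]
  ext i
  simp [xpart, wpart, Jmap, toE]

lemma dot_split (ζ z : ι2 d → ℝ) : ∑ i, ζ i * z i
    = dotE (xpart ζ) (xpart z) + dotE (wpart ζ) (wpart z) := by
  rw [Fintype.sum_sum_type]
  simp [dotE, xpart, wpart, toE]

lemma coeff_lattice {f : L2E d} {g : Euc d → ℂ} (hg : MemLp g 2) {M : ℝ}
    (hM : ∀ᵐ t : Euc d, ‖g t‖ ≤ M) (L : Matrix (ι2 d) (ι2 d) ℝ) (hL : IsUnit L.det) :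
    Integrable (fun w => ‖cf g (L.mulVec w) f‖ ^ 2) ∧ ∀ k : ι2 d → ℤ,
    ∫ w, ((‖cf g (L.mulVec w) f‖ ^ 2 : ℝ) : ℂ) * e2 (-(∑ i, (k i : ℝ) * w i))
      = ((|L.det|⁻¹ : ℝ) : ℂ) * (STFT g g (xpart (dualV L (-k))) (wpart (dualV L (-k)))
        * (starRingEnd ℂ) (STFT f f (xpart (dualV L (-k))) (wpart (dualV L (-k))))) := by
  have hdet : L.det ≠ 0 := hL.ne_zero
  have hmap := Real.map_matrix_volume_pi_eq_smul_volume_pi hdet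
  have hcont : Continuous (Matrix.toLin' L) := LinearMap.continuous_of_finiteDimensional _
  have hFc := (continuous_cf hg f).norm.pow 2
  constructor
  · have h1 := (ft_cf (f := f) hg hM 0 0).1
    have h2 : Integrable (fun z => ‖cf g z f‖ ^ 2) (Measure.map (Matrix.toLin' L) volume) := by
      rw [hmap]
      exact h1.smul_measure ENNReal.ofReal_ne_top
    exact h2.comp_measurable hcont.measurable
  intro k
  set ζ := (L⁻¹)ᵀ.mulVec fun i => (k i : ℝ) with hζ
  rw [xpart_dual_neg, wpart_dual_neg, ← hζ, ← (ft_cf (f := f) hg hM (xpart ζ) (wpart ζ)).2]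
  set K : (ι2 d → ℝ) → ℂ := fun z =>
    ((‖cf g z f‖ ^ 2 : ℝ) : ℂ) * e2 (-(dotE (xpart ζ) (xpart z) + dotE (wpart ζ) (wpart z))) with hK
  have hKc : Continuous K := by
    have h1 : Continuous fun z : ι2 d → ℝ => ∑ i, ζ i * z i := by fun_prop
    simp only [hK, ← dot_split]
    exact (Complex.continuous_ofReal.comp hFc).mul (continuous_e2.comp h1.neg)
  have e1 : ∀ w, ((‖cf g (L.mulVec w) f‖ ^ 2 : ℝ) : ℂ) * e2 (-(∑ i, (k i : ℝ) * w i))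
      = K (Matrix.toLin' L w) := by
    intro w
    simp only [hK, ← dot_split, Matrix.toLin'_apply]
    congr 3
    change (fun i => (k i : ℝ)) ⬝ᵥ w = ζ ⬝ᵥ (L.mulVec w)
    rw [hζ, Matrix.mulVec_transpose, ← Matrix.dotProduct_mulVec, Matrix.mulVec_mulVec,
      Matrix.nonsing_inv_mul _ hL, Matrix.one_mulVec]
  simp only [e1]
  rw [← integral_map hcont.aemeasurable hKc.aestronglyMeasurable, hmap, integral_smul_measure,
    ENNReal.toReal_ofReal (abs_nonneg _), abs_inv, Complex.real_smul]

lemma STFT_self_zero (f : Euc d → ℂ) : STFT f f 0 0 = ((∫ t, ‖f t‖ ^ 2 : ℝ) : ℂ) := by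
  rw [STFT, ← integral_complex_ofReal]
  apply integral_congr_ae
  filter_upwards with t
  have : dotE (0 : Euc d) t = 0 := by simp [dotE]
  rw [this, neg_zero, e2_zero, mul_one, sub_zero, Complex.mul_conj, Complex.normSq_eq_norm_sq]

lemma STFT_self_le (f : L2E d) (x ω : Euc d) : ‖STFT f f x ω‖ ≤ ‖f‖ ^ 2 := by
  have h : STFT f f x ω = cf f (Sum.elim (fun i => x i) (fun i => ω i)) f := by
    rw [STFT, cf]
    apply integral_congr_ae
    filter_upwards with t
    have h1 : xpart (Sum.elim (fun i => x i) (fun i => ω i)) = x := by ext i; simp [xpart, toE]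
    have h2 : wpart (Sum.elim (fun i => x i) (fun i => ω i)) = ω := by ext i; simp [wpart, toE]
    rw [tfs, h1, h2, map_mul, conj_e2]; ring
  rw [h, cf_eq_inner (Lp.memLp f)]
  refine (norm_inner_le_norm _ _).trans ?_
  rw [norm_Uop, Lp.toLp_coeFn, sq]

lemma xpart_dual_zero (L : Matrix (ι2 d) (ι2 d) ℝ) : xpart (dualV L 0) = 0 := by
  ext i
  simp [xpart, dualV, Jmap, toE, Matrix.mulVec, dotProduct]
lemma wpart_dual_zero (L : Matrix (ι2 d) (ι2 d) ℝ) : wpart (dualV L 0) = 0 := by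
  ext i
  simp [wpart, dualV, Jmap, toE, Matrix.mulVec, dotProduct]
lemma dual_zero (L : Matrix (ι2 d) (ι2 d) ℝ) : dualV L 0 = 0 := by
  ext i
  rcases i with i | i <;> simp [dualV, Jmap, Matrix.mulVec, dotProduct]

lemma poisson_bounds {g : Euc d → ℂ} (hg : MemLp g 2) {M : ℝ}
    (hM : ∀ᵐ t : Euc d, ‖g t‖ ≤ M) (L : Matrix (ι2 d) (ι2 d) ℝ) (hL : IsUnit L.det)
    (hV : Summable fun k : ι2 d → ℤ => ‖STFT g g (xpart (dualV L k)) (wpart (dualV L k))‖)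
    {σ N : ℝ} (hN : N = ∫ t, ‖g t‖ ^ 2)
    (hσ : ∑' k : ι2 d → ℤ, ‖STFT g g (xpart (dualV L k)) (wpart (dualV L k))‖ ≤ σ) (f : L2E d) :
    ∃ᶠ w in nhds (0 : ι2 d → ℝ), ∃ S,
      HasSum (fun κ : ι2 d → ℤ => ‖cf g (L.mulVec (w + fun i => (κ i : ℝ))) f‖ ^ 2) S ∧
        (2 * N - σ) / |L.det| * ‖f‖ ^ 2 ≤ S ∧ S ≤ σ / |L.det| * ‖f‖ ^ 2 := by
  set V : (ι2 d → ℤ) → ℂ := fun k => STFT g g (xpart (dualV L k)) (wpart (dualV L k)) with hVdef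
  set W : (ι2 d → ℤ) → ℂ := fun k => STFT f f (xpart (dualV L k)) (wpart (dualV L k)) with hWdef
  have hD : 0 < |L.det| := abs_pos.2 hL.ne_zero
  have hN0 : 0 ≤ N := by rw [hN]; positivity
  obtain ⟨hi, hc⟩ := coeff_lattice (f := f) hg hM L hL
  set c : (ι2 d → ℤ) → ℂ := fun k => ((|L.det|⁻¹ : ℝ) : ℂ) * (V (-k) * (starRingEnd ℂ) (W (-k)))
    with hcdef
  have hcn : ∀ k, ‖c k‖ ≤ |L.det|⁻¹ * ‖f‖ ^ 2 * ‖V (-k)‖ := by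
    intro k
    simp only [hcdef]
    rw [norm_mul, norm_mul, RCLike.norm_conj, Complex.norm_real, Real.norm_of_nonneg (by positivity)]
    have := STFT_self_le f (xpart (dualV L (-k))) (wpart (dualV L (-k)))
    calc |L.det|⁻¹ * (‖V (-k)‖ * ‖W (-k)‖) ≤ |L.det|⁻¹ * (‖V (-k)‖ * ‖f‖ ^ 2) := by
          gcongr
      _ = _ := by ring
  have hVn : Summable fun k : ι2 d → ℤ => ‖V (-k)‖ :=
    (Equiv.neg (ι2 d → ℤ)).summable_iff.2 hV
  have hVt : ∑' k : ι2 d → ℤ, ‖V (-k)‖ = ∑' k : ι2 d → ℤ, ‖V k‖ :=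
    (Equiv.neg (ι2 d → ℤ)).tsum_eq fun k => ‖V k‖
  have hcs : Summable fun k => ‖c k‖ :=
    Summable.of_nonneg_of_le (fun _ => norm_nonneg _) hcn (hVn.mul_left _)
  have hV0 : V 0 = (N : ℂ) := by
    simp only [hVdef]
    rw [xpart_dual_zero, wpart_dual_zero, STFT_self_zero, hN]
  have hW0 : W 0 = ((‖f‖ ^ 2 : ℝ) : ℂ) := by
    simp only [hWdef]
    rw [xpart_dual_zero, wpart_dual_zero, STFT_self_zero, norm_sq_L2]
  have hc0 : c 0 = ((|L.det|⁻¹ * ‖f‖ ^ 2 * N : ℝ) : ℂ) := by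
    simp only [hcdef]
    rw [neg_zero, hV0, hW0, Complex.conj_ofReal]
    push_cast; ring
  refine (poisson_frequently (fun w => ‖cf g (L.mulVec w) f‖ ^ 2) (fun _ => by positivity) ?_ hi c hc
    hcs).mono ?_
  · exact ((continuous_cf hg f).comp
      (LinearMap.continuous_of_finiteDimensional (Matrix.toLin' L))).norm.pow 2
  intro w hw
  refine ⟨_, hw, ?_⟩
  set Q := ∑' k, c k * e2 (∑ i, (k i : ℝ) * w i) with hQ
  have hQs : HasSum (fun k => c k * e2 (∑ i, (k i : ℝ) * w i)) Q := by
    refine (Summable.of_norm ?_).hasSum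
    simpa [norm_mul, norm_e2] using hcs
  have hd := hQs.sub (hasSum_ite_eq (0 : ι2 d → ℤ) (c 0))
  have hr := ((hVn.hasSum.sub (hasSum_ite_eq (0 : ι2 d → ℤ) N)).mul_left (|L.det|⁻¹ * ‖f‖ ^ 2))
  have hb : ‖Q - c 0‖ ≤ |L.det|⁻¹ * ‖f‖ ^ 2 * ((∑' k : ι2 d → ℤ, ‖V (-k)‖) - N) := by
    rw [← hd.tsum_eq]
    refine tsum_of_norm_bounded hr fun k => ?_
    by_cases hk : k = 0
    · subst hk
      have : ∑ i, (((0 : ι2 d → ℤ) i : ℤ) : ℝ) * w i = 0 := by simp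
      rw [if_pos rfl, if_pos rfl, this, e2_zero, mul_one, sub_self, norm_zero, neg_zero, hV0,
        Complex.norm_real, Real.norm_of_nonneg hN0, sub_self, mul_zero]
    · rw [if_neg hk, if_neg hk, sub_zero, sub_zero, norm_mul, norm_e2, mul_one]
      exact hcn k
  have hre : |Q.re - |L.det|⁻¹ * ‖f‖ ^ 2 * N| ≤ |L.det|⁻¹ * ‖f‖ ^ 2 * (σ - N) := by
    have h1 := (Complex.abs_re_le_norm (Q - c 0)).trans hb
    rw [Complex.sub_re, hc0, Complex.ofReal_re] at h1
    refine h1.trans ?_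
    rw [hVt]
    gcongr
  rw [abs_le] at hre
  rw [div_eq_inv_mul, div_eq_inv_mul]
  constructor <;> nlinarith [hre.1, hre.2]

lemma g_bdd {g G : Euc d → ℂ} (hginv : ∀ᵐ x : Euc d, g x = ∫ ω : Euc d, G ω * e2 (dotE x ω)) :
    ∀ᵐ t : Euc d, ‖g t‖ ≤ ∫ ω, ‖G ω‖ := by
  filter_upwards [hginv] with t ht
  rw [ht]
  refine (norm_integral_le_integral_norm _).trans (le_of_eq ?_)
  simp [norm_e2]

lemma g_L2 {g : Euc d → ℂ} (hg : Integrable g) {M : ℝ} (hM : ∀ᵐ t : Euc d, ‖g t‖ ≤ M) :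
    MemLp g 2 := by
  rw [memLp_two_iff_integrable_sq_norm hg.1]
  refine (hg.norm.const_mul M).mono' (hg.1.norm.pow 2) ?_
  filter_upwards [hM] with t ht
  rw [Real.norm_of_nonneg (by positivity), sq]
  gcongr

end Fin

/-- sufficient condition for generalized Gabor frames: if `g ≠ 0`,
`ĝ = G ∈ L¹` and `∑_{κ≠0} v(𝒥L^{-T}κ)|V_g g(𝒥L^{-T}κ)| < ‖g‖²_{L²}`, then
`{π_{Lκ}g}_{κ∈ℤ^{2d}}` is a frame for `L²(ℝ^d)` with bounds
`A = (2‖g‖² - σ_{L,g})/|det L|` and `B = σ_{L,g}/|det L| < 2‖g‖²/|det L|`. -/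
theorem stmt12 {d : ℕ} (s : ℝ) (hs : 0 ≤ s) (g G : Euc d → ℂ)
    (hg : Integrable g) (hG : Integrable G)
    (hg_meas : AEStronglyMeasurable g volume)
    (hginv : ∀ᵐ x : Euc d, g x = ∫ ω : Euc d, G ω * e2 (dotE x ω))
    (hg0 : ¬ (g =ᵐ[volume] 0))
    (L : Matrix (ι2 d) (ι2 d) ℝ) (hL : IsUnit L.det)
    (hσ : Summable fun κ : {κ : ι2 d → ℤ // κ ≠ 0} =>
      (1 + norm2 (dualV L κ.1)) ^ s
        * ‖STFT g g (xpart (dualV L κ.1)) (wpart (dualV L κ.1))‖)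
    (hlt : (∑' κ : {κ : ι2 d → ℤ // κ ≠ 0},
        (1 + norm2 (dualV L κ.1)) ^ s
          * ‖STFT g g (xpart (dualV L κ.1)) (wpart (dualV L κ.1))‖)
      < ∫ t : Euc d, ‖g t‖ ^ 2) :
    (0 < (2 * (∫ t : Euc d, ‖g t‖ ^ 2)
          - ∑' κ : ι2 d → ℤ,
              (1 + norm2 (dualV L κ)) ^ s
                * ‖STFT g g (xpart (dualV L κ)) (wpart (dualV L κ))‖) / |L.det|)
    ∧ ((∑' κ : ι2 d → ℤ,
          (1 + norm2 (dualV L κ)) ^ s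
            * ‖STFT g g (xpart (dualV L κ)) (wpart (dualV L κ))‖) / |L.det|
        < 2 * (∫ t : Euc d, ‖g t‖ ^ 2) / |L.det|)
    ∧ ∀ f : Lp ℂ 2 (volume : Measure (Euc d)),
        Summable (fun κ : ι2 d → ℤ =>
          ‖∫ t : Euc d, f t * (starRingEnd ℂ) (tfs (latV L κ) g t)‖ ^ 2)
        ∧ (2 * (∫ t : Euc d, ‖g t‖ ^ 2)
              - ∑' κ : ι2 d → ℤ,
                  (1 + norm2 (dualV L κ)) ^ s
                    * ‖STFT g g (xpart (dualV L κ)) (wpart (dualV L κ))‖) / |L.det|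
              * ‖f‖ ^ 2
            ≤ ∑' κ : ι2 d → ℤ,
                ‖∫ t : Euc d, f t * (starRingEnd ℂ) (tfs (latV L κ) g t)‖ ^ 2
        ∧ (∑' κ : ι2 d → ℤ,
              ‖∫ t : Euc d, f t * (starRingEnd ℂ) (tfs (latV L κ) g t)‖ ^ 2)
            ≤ (∑' κ : ι2 d → ℤ,
                (1 + norm2 (dualV L κ)) ^ s
                  * ‖STFT g g (xpart (dualV L κ)) (wpart (dualV L κ))‖) / |L.det|
              * ‖f‖ ^ 2 := by
  set N := ∫ t : Euc d, ‖g t‖ ^ 2 with hN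
  set F : (ι2 d → ℤ) → ℝ := fun κ => (1 + norm2 (dualV L κ)) ^ s
    * ‖STFT g g (xpart (dualV L κ)) (wpart (dualV L κ))‖ with hF
  have hM := g_bdd hginv
  have hg2 := g_L2 hg hM
  have hD : 0 < |L.det| := abs_pos.2 hL.ne_zero
  have hN0 : 0 ≤ N := by positivity
  have hF0 : F 0 = N := by
    simp only [hF]
    rw [xpart_dual_zero, wpart_dual_zero, dual_zero, STFT_self_zero, Complex.norm_real,
      Real.norm_of_nonneg (by positivity)]
    have : norm2 (0 : ι2 d → ℝ) = 0 := by
      rw [norm2, map_zero, norm_zero]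
    rw [this, add_zero, Real.one_rpow, one_mul]
  set T := ∑' κ : {κ : ι2 d → ℤ // κ ≠ 0}, F κ.1 with hT
  have hsumF : HasSum F (T + N) := by
    have h1 : HasSum (fun κ : {κ : ι2 d → ℤ // κ ≠ 0} => F κ.1) T := hσ.hasSum
    have h2 : HasSum (Set.indicator {κ : ι2 d → ℤ | κ ≠ 0} F) T :=
      hasSum_subtype_iff_indicator.1 h1
    have h3 := h2.add (hasSum_ite_eq (0 : ι2 d → ℤ) N)
    refine h3.congr_fun ?_
    intro κ
    by_cases hκ : κ = 0
    · subst hκ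
      simp [hF0]
    · simp [hκ]
  have hσeq : ∑' κ : ι2 d → ℤ, F κ = T + N := hsumF.tsum_eq
  rw [hσeq]
  have hle : ∀ κ : ι2 d → ℤ, ‖STFT g g (xpart (dualV L κ)) (wpart (dualV L κ))‖ ≤ F κ := by
    intro κ
    have h1 : 1 ≤ (1 + norm2 (dualV L κ)) ^ s := by
      apply Real.one_le_rpow _ hs
      have : 0 ≤ norm2 (dualV L κ) := norm_nonneg _
      linarith
    exact le_mul_of_one_le_left (norm_nonneg _) h1
  have hV : Summable fun k : ι2 d → ℤ => ‖STFT g g (xpart (dualV L k)) (wpart (dualV L k))‖ :=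
    Summable.of_nonneg_of_le (fun _ => norm_nonneg _) hle hsumF.summable
  have hVle : ∑' k : ι2 d → ℤ, ‖STFT g g (xpart (dualV L k)) (wpart (dualV L k))‖ ≤ T + N :=
    hasSum_le hle hV.hasSum hsumF
  refine ⟨div_pos (by linarith) hD, ?_, ?_⟩
  · gcongr
    linarith
  · intro f
    exact frame_of_frequently hg2 L _ _ (poisson_bounds hg2 hM L hL hV hN hVle) f
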